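/- Let Γ be a theory consisting only of 0-formulas over signature Σ = ⟨C,F,P⟩ and let I be a set of ground atoms. Then I is a stable model of Γ under the SQHT=_S equilibrium semantics if and only if I is a stable model of Γ under the SQHT=_F equilibrium semantics over the signature ⟨C∪S,F,P⟩. -/

import Mathlib

open Classical

noncomputable section

/-! ## Worlds (here and there) -/

inductive W : Type
  | h
  | t

/-- The ordering `h ≤ t` on worlds. -/
def W.le : W → W → Prop
  | .h, _ => True
  | .t, .t => True
  | .t, .h => False

/-! ## Tuples: nonempty finite tuples, encoded as head + tail -/

abbrev Tup (α : Type u) : Type u := α × List α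

/-- The tuple `(g 0, …, g n)` determined by a family on `Fin (n+1)`. -/
def famToTup {α : Type u} {n : ℕ} (g : Fin (n + 1) → α) : Tup α :=
  (g 0, List.ofFn fun i : Fin n => g i.succ)

/-- Combine a finite family of optional values into an optional family:
`some` iff all components are defined. -/
def optFam {α : Type u} {m : ℕ} (f : Fin m → Option α) : Option (Fin m → α) :=
  if h : ∀ i, (f i).isSome then some fun i => (f i).get (h i) else none

/-! ## The domain `D`: atoms (Herbrand terms) plus, at each finite level,
all sets of (nonempty) tuples over the previous level.
We realise it as the quotient of a type of "pre-domain elements" of finite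
rank by extensional equivalence. -/

/-- Pre-domain elements over a type `A` of atoms: an atom, or a set of
nonempty tuples (each tuple encoded as head + tail), indexed by an arbitrary
(small) index type. -/
inductive PD (A : Type) : Type 1
  | atom : A → PD A
  | set : (ι : Type) → (ι → PD A) → (ι → List (PD A)) → PD A

/-- `x` has rank at most `n` (atoms have rank `0`). -/
def PD.rankLe {A : Type} : ℕ → PD A → Prop
  | 0, .atom _ => True
  | 0, .set _ _ _ => False
  | _ + 1, .atom _ => True
  | n + 1, .set _ hd tl => ∀ i, PD.rankLe n (hd i) ∧ ∀ z ∈ tl i, PD.rankLe n z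

/-- Finite rank: the element appears at some finite level `D^i` of the
domain hierarchy. -/
def PD.FiniteRank {A : Type} (x : PD A) : Prop := ∃ n, PD.rankLe n x

/-- Extensional equivalence up to depth `n`. -/
def PD.EquivLe {A : Type} : ℕ → PD A → PD A → Prop
  | 0, .atom a, .atom b => a = b
  | 0, _, _ => False
  | _ + 1, .atom a, .atom b => a = b
  | n + 1, .set _ hd tl, .set _ hd' tl' =>
      (∀ i, ∃ j, PD.EquivLe n (hd i) (hd' j) ∧ List.Forall₂ (PD.EquivLe n) (tl i) (tl' j)) ∧
      (∀ j, ∃ i, PD.EquivLe n (hd i) (hd' j) ∧ List.Forall₂ (PD.EquivLe n) (tl i) (tl' j))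
  | _ + 1, _, _ => False

/-- Extensional equivalence (witnessed at some finite depth). -/
def PD.Equiv {A : Type} (x y : PD A) : Prop := ∃ n, PD.EquivLe n x y

/-- The domain over atoms `A`: finite-rank pre-domain elements modulo
extensional equivalence. -/
def DD (A : Type) : Type 1 :=
  Quot fun x y : { z : PD A // z.FiniteRank } => PD.Equiv x.1 y.1

def toD {A : Type} (x : PD A) (h : x.FiniteRank) : DD A := Quot.mk _ ⟨x, h⟩

def atomD {A : Type} (a : A) : DD A := toD (PD.atom a) ⟨0, by simp [PD.rankLe]⟩

/-- `z` (a pre-domain element) represents the domain element `w`. -/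
def repD {A : Type} (z : PD A) (w : DD A) : Prop := ∃ h, w = toD z h

/-- Membership of a tuple in a domain element (meaningful when the latter
is a set). -/
def dmem {A : Type} (v : Tup (DD A)) (d : DD A) : Prop :=
  ∃ (ι : Type) (hd : ι → PD A) (tl : ι → List (PD A)) (hfr : (PD.set ι hd tl).FiniteRank),
    d = toD (PD.set ι hd tl) hfr ∧ ∃ i, repD (hd i) v.1 ∧ List.Forall₂ repD (tl i) v.2

/-- The domain elements that are sets (the subset `𝒮 = D ∖ D⁰`). -/
def IsSetD {A : Type} (d : DD A) : Prop :=
  ∃ (ι : Type) (hd : ι → PD A) (tl : ι → List (PD A)) (hfr : (PD.set ι hd tl).FiniteRank),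
    d = toD (PD.set ι hd tl) hfr

/-- The domain element whose members are exactly the tuples in `s`
(`none` if there is no such element of the domain). -/
def mkSet? {A : Type} (s : Set (Tup (DD A))) : Option (DD A) :=
  if h : ∃ d : DD A, IsSetD d ∧ ∀ v, dmem v d ↔ v ∈ s then some h.choose else none


universe v

/-! ## Signatures -/

/-- A signature: Herbrand function (constructor) names `C`, evaluable
function names `F`, and predicate names `P`, each with an arity, with at
least one Herbrand constant. -/
structure Sig : Type (v + 1) where
  C : Type
  arC : C → ℕ
  F : Type v
  arF : F → ℕ
  P : Type
  arP : P → ℕ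
  hasConst : ∃ c, arC c = 0

/-- Ground Herbrand terms over constructors `C`. -/
inductive HTerm (C : Type) (ar : C → ℕ) : Type
  | mk : (c : C) → (Fin (ar c) → HTerm C ar) → HTerm C ar

/-- The domain `D` of a signature: the Herbrand universe `Terms_F(C)`
together with all (finite-level) sets of nonempty tuples over it. -/
abbrev D (S : Sig.{v}) : Type 1 := DD (HTerm S.C S.arC)

/-! ## Terms and formulas (with extensional and intensional sets).
Quantified variables and the variables bound by an intensional set are
handled by substitution of arbitrary domain elements (which are available
as constant terms via `GTerm.dom`), so terms and formulas below are the
*ground* terms and *sentences* of the language. -/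

mutual
  inductive GTerm (S : Sig.{v}) : Type (max 1 v)
    /-- every element of the domain is a (ground) term -/
    | dom : D S → GTerm S
    /-- Herbrand (constructor) function application -/
    | ctor : (c : S.C) → (Fin (S.arC c) → GTerm S) → GTerm S
    /-- evaluable function application -/
    | func : (f : S.F) → (Fin (S.arF f) → GTerm S) → GTerm S
    /-- extensional set `{τ⃗₁, …, τ⃗_m}` of `m` tuples of terms, each of
    arity `n+1` -/
    | eset : (m n : ℕ) → (Fin m → Fin (n + 1) → GTerm S) → GTerm S
    /-- intensional set `{x⃗ : τ⃗(x⃗) : φ(x⃗)}` with `k` bound variables and a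
    tuple of `n+1` terms -/
    | iset : (k n : ℕ) → ((Fin k → D S) → Fin (n + 1) → GTerm S) →
        ((Fin k → D S) → Formula S) → GTerm S

  inductive Formula (S : Sig.{v}) : Type (max 1 v)
    | falsum : Formula S
    | verum : Formula S
    | atom : (p : S.P) → (Fin (S.arP p) → GTerm S) → Formula S
    | eq : GTerm S → GTerm S → Formula S
    | and : Formula S → Formula S → Formula S
    | or : Formula S → Formula S → Formula S
    | imp : Formula S → Formula S → Formula S
    | all : (D S → Formula S) → Formula S
    | ex : (D S → Formula S) → Formula S
end

/-- `¬φ` is an abbreviation for `φ → ⊥`. -/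
def Formula.neg {S : Sig.{v}} (φ : Formula S) : Formula S := .imp φ .falsum

/-- Ground atoms over the domain: the Herbrand base. -/
def GAtom (S : Sig.{v}) : Type 1 := Σ p : S.P, Fin (S.arP p) → D S

/-! ## Assignments and interpretations -/

/-- An assignment maps every ground term to a domain element or `none`
(undefined, `u`). -/
abbrev Assign (S : Sig.{v}) := GTerm S → Option (D S)

/-- The conditions an assignment must satisfy: identity on domain
constants, strictness and substitutivity for function application, the
Herbrand interpretation of constructors on atoms, and evaluation of
extensional set terms. -/
def AssignValid {S : Sig.{v}} (σ : Assign S) : Prop :=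
  (∀ d, σ (.dom d) = some d) ∧
  (∀ c args, (∃ i, σ (args i) = none) → σ (.ctor c args) = none) ∧
  (∀ c args (ds : Fin (S.arC c) → D S), (∀ i, σ (args i) = some (ds i)) →
      σ (.ctor c args) = σ (.ctor c fun i => .dom (ds i))) ∧
  (∀ c (hs : Fin (S.arC c) → HTerm S.C S.arC),
      σ (.ctor c fun i => .dom (atomD (hs i))) = some (atomD (HTerm.mk c hs))) ∧
  (∀ f args, (∃ i, σ (args i) = none) → σ (.func f args) = none) ∧
  (∀ f args (ds : Fin (S.arF f) → D S), (∀ i, σ (args i) = some (ds i)) →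
      σ (.func f args) = σ (.func f fun i => .dom (ds i))) ∧
  (∀ m n tups, (∃ j i, σ (tups j i) = none) → σ (.eset m n tups) = none) ∧
  (∀ m n tups (ds : Fin m → Fin (n + 1) → D S), (∀ j i, σ (tups j i) = some (ds j i)) →
      σ (.eset m n tups) = mkSet? { v | ∃ j, v = famToTup (ds j) })

/-- `σ ≼ σ'` : on every ground term, `σ` agrees with `σ'` or is undefined. -/
def AssignLe {S : Sig.{v}} (σ σ' : Assign S) : Prop :=
  ∀ τ, σ τ = σ' τ ∨ σ τ = none

/-- An interpretation `⟨σʰ, σᵗ, Iʰ, Iᵗ⟩`. -/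
structure Interp (S : Sig.{v}) : Type (max 1 v) where
  sh : Assign S
  st : Assign S
  Ih : Set (GAtom S)
  It : Set (GAtom S)

/-- The assignment of `I` at world `w`. -/
def Interp.s {S : Sig.{v}} (I : Interp S) : W → Assign S
  | .h => I.sh
  | .t => I.st

/-- The atoms of `I` at world `w`. -/
def Interp.atoms {S : Sig.{v}} (I : Interp S) : W → Set (GAtom S)
  | .h => I.Ih
  | .t => I.It

/-- The defining conditions of an interpretation: both assignments are
proper assignments, `σʰ ≼ σᵗ` and `Iʰ ⊆ Iᵗ`. -/
def Interp.Valid {S : Sig.{v}} (I : Interp S) : Prop :=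
  AssignValid I.sh ∧ AssignValid I.st ∧ AssignLe I.sh I.st ∧ I.Ih ⊆ I.It

/-! ## 𝒮-satisfaction -/

/-- `SatS I w φ` : `I, w ⊨_𝒮 φ`. -/
def SatS {S : Sig.{v}} (I : Interp S) : W → Formula S → Prop
  | _, .falsum => False
  | _, .verum => True
  | w, .atom p args => ∃ ds : Fin (S.arP p) → D S,
      (∀ i, I.s w (args i) = some (ds i)) ∧ (⟨p, ds⟩ : GAtom S) ∈ I.atoms w
  | w, .eq t1 t2 => ∃ d, I.s w t1 = some d ∧ I.s w t2 = some d
  | w, .and a b => SatS I w a ∧ SatS I w b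
  | w, .or a b => SatS I w a ∨ SatS I w b
  | w, .imp a b => ∀ w', W.le w w' → (SatS I w' a → SatS I w' b)
  | w, .all b => ∀ d, SatS I w (b d)
  | w, .ex b => ∃ d, SatS I w (b d)

/-! ## Extension of intensional sets and the coherent closure -/

/-- The extension `ext(I, w, {x⃗ : τ⃗(x⃗) : φ(x⃗)})`: the set of values of the
tuples `τ⃗(c⃗)` for those `c⃗ ∈ D^k` with `I, w ⊨_𝒮 φ(c⃗)`; it is undefined if
one of these values is undefined (or if the resulting collection is not a
member of the domain). -/
def extw {S : Sig.{v}} (I : Interp S) (w : W) (k n : ℕ)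
    (tv : (Fin k → D S) → Fin (n + 1) → GTerm S)
    (φ : (Fin k → D S) → Formula S) : Option (D S) :=
  if ∃ c : Fin k → D S, SatS I w (φ c) ∧ ∃ i, I.s w (tv c i) = none then none
  else
    mkSet? { val | ∃ (c : Fin k → D S) (ds : Fin (n + 1) → D S),
      SatS I w (φ c) ∧ (∀ i, I.s w (tv c i) = some (ds i)) ∧ val = famToTup ds }

/-- The assignment `σ_I^w` of the coherent closure of `I`: it agrees with
`σ^w` on terms without intensional sets, it assigns to an intensional set
its extension at `t`, at `h` its extension when the two extensions agree
(and `u` otherwise), and is extended to all remaining terms by the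
assignment conditions. -/
def cval {S : Sig.{v}} (I : Interp S) (w : W) : GTerm S → Option (D S)
  | .dom d => some d
  | .ctor c args =>
      match optFam fun i => cval I w (args i) with
      | none => none
      | some ds => I.s w (.ctor c fun i => .dom (ds i))
  | .func f args =>
      match optFam fun i => cval I w (args i) with
      | none => none
      | some ds => I.s w (.func f fun i => .dom (ds i))
  | .eset _ _ tups =>
      match optFam fun j => optFam fun i => cval I w (tups j i) with
      | none => none
      | some g => mkSet? { val | ∃ j, val = famToTup (g j) }
  | .iset k n tv φ =>
      match w with
      | .t => extw I .t k n tv φ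
      | .h => if extw I .h k n tv φ = extw I .t k n tv φ then extw I .h k n tv φ else none

/-- The coherent closure `C(I)` of an interpretation. -/
def CohC {S : Sig.{v}} (I : Interp S) : Interp S :=
  ⟨cval I .h, cval I .t, I.Ih, I.It⟩

/-- `I` is coherent (w.r.t. intensional sets) iff `I = C(I)`. -/
def Interp.Coherent {S : Sig.{v}} (I : Interp S) : Prop := CohC I = I

/-! ## 0-formulas (no intensional sets) and `SQHT⁼_F` over `⟨C ∪ 𝒮, F, P⟩`.
A `0`-formula over `Σ = ⟨C, F, P⟩` is at the same time an `SQHT⁼_F` formula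
over the signature `⟨C ∪ 𝒮, F, P⟩`, whose Herbrand universe is the domain
`D`.  An `SQHT⁼_F` interpretation over `⟨C ∪ 𝒮, F, P⟩` is an interpretation
whose assignments are only defined on terms without intensional sets. -/

mutual
  def IsZeroT {S : Sig.{v}} : GTerm S → Prop
    | .dom _ => True
    | .ctor _ args => ∀ i, IsZeroT (args i)
    | .func _ args => ∀ i, IsZeroT (args i)
    | .eset _ _ tups => ∀ j i, IsZeroT (tups j i)
    | .iset _ _ _ _ => False

  def IsZeroF {S : Sig.{v}} : Formula S → Prop
    | .falsum => True
    | .verum => True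
    | .atom _ args => ∀ i, IsZeroT (args i)
    | .eq t1 t2 => IsZeroT t1 ∧ IsZeroT t2
    | .and a b => IsZeroF a ∧ IsZeroF b
    | .or a b => IsZeroF a ∧ IsZeroF b
    | .imp a b => IsZeroF a ∧ IsZeroF b
    | .all b => ∀ d, IsZeroF (b d)
    | .ex b => ∀ d, IsZeroF (b d)
end

/-- An `SQHT⁼_F` interpretation over `⟨C ∪ 𝒮, F, P⟩`: assignments are given
on the terms without intensional sets only. -/
structure FInterp (S : Sig.{v}) : Type (max 1 v) where
  sh : { τ : GTerm S // IsZeroT τ } → Option (D S)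
  st : { τ : GTerm S // IsZeroT τ } → Option (D S)
  Ih : Set (GAtom S)
  It : Set (GAtom S)

/-- The restriction `Î` of an `SQHT⁼_𝒮` interpretation to the terms without
intensional sets. -/
def Interp.hat {S : Sig.{v}} (I : Interp S) : FInterp S :=
  ⟨fun τ => I.sh τ.1, fun τ => I.st τ.1, I.Ih, I.It⟩

/-- The canonical extension of an `SQHT⁼_F` interpretation to all terms
(undefined outside terms without intensional sets); it is used to evaluate
`SQHT⁼_F` satisfaction, which only depends on the values on terms without
intensional sets. -/
def FInterp.toInterp {S : Sig.{v}} (J : FInterp S) : Interp S :=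
  ⟨fun τ => if h : IsZeroT τ then J.sh ⟨τ, h⟩ else none,
   fun τ => if h : IsZeroT τ then J.st ⟨τ, h⟩ else none, J.Ih, J.It⟩

/-- `SQHT⁼_F` satisfaction `I, w ⊨_F φ` (for `0`-formulas `φ`, i.e.
`SQHT⁼_F` formulas over `⟨C ∪ 𝒮, F, P⟩`): the same clauses as `⊨_𝒮`, with
quantifiers ranging over the Herbrand universe of `⟨C ∪ 𝒮, F, P⟩`. -/
def SatF {S : Sig.{v}} (J : FInterp S) (w : W) (φ : Formula S) : Prop :=
  SatS J.toInterp w φ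

/-- Validity of an `SQHT⁼_F` interpretation. -/
def FInterp.Valid {S : Sig.{v}} (J : FInterp S) : Prop := J.toInterp.Valid

/-! ## Orderings between interpretations, equilibrium and stable models -/

/-- `I₁ ≼ I₂` : same `there` component, smaller `here` component. -/
def ILe {S : Sig.{v}} (I1 I2 : Interp S) : Prop :=
  I1.It = I2.It ∧ I1.st = I2.st ∧ I1.Ih ⊆ I2.Ih ∧ AssignLe I1.sh I2.sh

/-- `I₁ ≺ I₂`. -/
def ILt {S : Sig.{v}} (I1 I2 : Interp S) : Prop := ILe I1 I2 ∧ I1 ≠ I2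

/-- The total interpretation `⟨σ, T⟩`. -/
def totalI {S : Sig.{v}} (σ : Assign S) (T : Set (GAtom S)) : Interp S := ⟨σ, σ, T, T⟩

/-- `I` is a model of the theory `Γ` : `I` is a (coherent) interpretation
and `I, h ⊨_𝒮 φ` for every `φ ∈ Γ`. -/
def ModelS {S : Sig.{v}} (I : Interp S) (Γ : Set (Formula S)) : Prop :=
  I.Valid ∧ I.Coherent ∧ ∀ φ ∈ Γ, SatS I .h φ

/-- `⟨σ, T⟩` is an equilibrium model of `Γ`. -/
def EqModelS {S : Sig.{v}} (Γ : Set (Formula S)) (σ : Assign S) (T : Set (GAtom S)) : Prop :=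
  ModelS (totalI σ T) Γ ∧ ∀ I', ILt I' (totalI σ T) → ¬ ModelS I' Γ

/-- `T` is a stable model of `Γ` (`SQHT⁼_𝒮` equilibrium semantics). -/
def StableS {S : Sig.{v}} (Γ : Set (Formula S)) (T : Set (GAtom S)) : Prop :=
  ∃ σ, EqModelS Γ σ T

/-- The ordering on `SQHT⁼_F` assignments. -/
def FAssignLe {S : Sig.{v}} (σ σ' : { τ : GTerm S // IsZeroT τ } → Option (D S)) : Prop :=
  ∀ τ, σ τ = σ' τ ∨ σ τ = none

/-- `≼` on `SQHT⁼_F` interpretations. -/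
def FILe {S : Sig.{v}} (J1 J2 : FInterp S) : Prop :=
  J1.It = J2.It ∧ J1.st = J2.st ∧ J1.Ih ⊆ J2.Ih ∧ FAssignLe J1.sh J2.sh

def FILt {S : Sig.{v}} (J1 J2 : FInterp S) : Prop := FILe J1 J2 ∧ J1 ≠ J2

def totalF {S : Sig.{v}} (σ : { τ : GTerm S // IsZeroT τ } → Option (D S))
    (T : Set (GAtom S)) : FInterp S := ⟨σ, σ, T, T⟩

/-- `J` is an `SQHT⁼_F` model of `Γ`. -/
def ModelF {S : Sig.{v}} (J : FInterp S) (Γ : Set (Formula S)) : Prop :=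
  J.Valid ∧ ∀ φ ∈ Γ, SatF J .h φ

/-- `T` is a stable model of `Γ` under the `SQHT⁼_F` equilibrium semantics
over the signature `⟨C ∪ 𝒮, F, P⟩`. -/
def StableF {S : Sig.{v}} (Γ : Set (Formula S)) (T : Set (GAtom S)) : Prop :=
  ∃ σ, ModelF (totalF σ T) Γ ∧ ∀ J', FILt J' (totalF σ T) → ¬ ModelF J' Γ

/-! ## Families of optional values -/

theorem optFam_eq_none {α : Type u} {m : ℕ} {f : Fin m → Option α} :
    optFam f = none ↔ ∃ i, f i = none := by
  unfold optFam
  split_ifs with h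
  · simp only [false_iff, not_exists]
    intro i hi
    simpa [hi] using h i
  · simpa using h

theorem optFam_eq_some {α : Type u} {m : ℕ} {f : Fin m → Option α} {g : Fin m → α} :
    optFam f = some g ↔ ∀ i, f i = some (g i) := by
  unfold optFam
  split_ifs with h
  · simp only [Option.some.injEq, funext_iff]
    exact forall_congr' fun i => by rw [← Option.some_inj, Option.some_get]
  · simp only [false_iff]
    exact fun hg => h fun i => by simp [hg i]

theorem optFam_some {α : Type u} {m : ℕ} (g : Fin m → α) :
    optFam (fun i => some (g i)) = some g :=
  optFam_eq_some.2 fun _ => rfl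

/-- If `f` is pointwise equal to `g` or undefined, then so is the combined family. -/
theorem optFam_le {α : Type u} {m : ℕ} {f g : Fin m → Option α}
    (h : ∀ i, f i = g i ∨ f i = none) : optFam f = optFam g ∨ optFam f = none := by
  by_cases hf : ∃ i, f i = none
  · exact Or.inr (optFam_eq_none.2 hf)
  · exact Or.inl (congrArg optFam (funext fun i => (h i).resolve_right fun hi => hf ⟨i, hi⟩))

theorem optFam₂_eq_none {α : Type u} {m n : ℕ} {f : Fin m → Fin n → Option α} :
    (optFam fun j => optFam (f j)) = none ↔ ∃ j i, f j i = none := by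
  simp only [optFam_eq_none]

theorem optFam₂_eq_some {α : Type u} {m n : ℕ} {f : Fin m → Fin n → Option α}
    {g : Fin m → Fin n → α} :
    (optFam fun j => optFam (f j)) = some g ↔ ∀ j i, f j i = some (g j i) := by
  simp only [optFam_eq_some]

/-! ## Assignments as solutions of evaluation equations -/

theorem assignValid_iff {S : Sig.{v}} (σ : Assign S) : AssignValid σ ↔
    (∀ d, σ (.dom d) = some d) ∧
    (∀ c args, σ (.ctor c args) =
      (optFam fun i => σ (args i)).bind fun ds => σ (.ctor c fun i => .dom (ds i))) ∧
    (∀ c (hs : Fin (S.arC c) → HTerm S.C S.arC),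
      σ (.ctor c fun i => .dom (atomD (hs i))) = some (atomD (HTerm.mk c hs))) ∧
    (∀ f args, σ (.func f args) =
      (optFam fun i => σ (args i)).bind fun ds => σ (.func f fun i => .dom (ds i))) ∧
    (∀ m n (tups : Fin m → Fin (n + 1) → GTerm S), σ (.eset m n tups) =
      (optFam fun j => optFam fun i => σ (tups j i)).bind
        fun g => mkSet? { v | ∃ j, v = famToTup (g j) }) := by
  constructor
  · rintro ⟨h1, h2, h3, h4, h5, h6, h7, h8⟩
    refine ⟨h1, fun c args => ?_, h4, fun f args => ?_, fun m n tups => ?_⟩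
    · cases h : optFam fun i => σ (args i) with
      | none => exact h2 c args (optFam_eq_none.1 h)
      | some ds => exact h3 c args ds (optFam_eq_some.1 h)
    · cases h : optFam fun i => σ (args i) with
      | none => exact h5 f args (optFam_eq_none.1 h)
      | some ds => exact h6 f args ds (optFam_eq_some.1 h)
    · cases h : optFam fun j => optFam fun i => σ (tups j i) with
      | none => exact h7 m n tups (optFam₂_eq_none.1 h)
      | some g => exact h8 m n tups g (optFam₂_eq_some.1 h)
  · rintro ⟨h1, h2, h3, h4, h5⟩
    refine ⟨h1, fun c args h => ?_, fun c args ds h => ?_, h3, fun f args h => ?_,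
      fun f args ds h => ?_, fun m n tups h => ?_, fun m n tups ds h => ?_⟩
    · rw [h2, optFam_eq_none.2 h, Option.bind_none]
    · rw [h2, optFam_eq_some.2 h, Option.bind_some]
    · rw [h4, optFam_eq_none.2 h, Option.bind_none]
    · rw [h4, optFam_eq_some.2 h, Option.bind_some]
    · rw [h5, optFam₂_eq_none.2 h, Option.bind_none]
    · rw [h5, optFam₂_eq_some.2 h, Option.bind_some]

theorem Interp.Valid.assign {S : Sig.{v}} {I : Interp S} (hI : I.Valid) :
    ∀ w, AssignValid (I.s w)
  | .h => hI.1
  | .t => hI.2.1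

theorem Interp.Valid.s_h_le {S : Sig.{v}} {I : Interp S} (hI : I.Valid) :
    AssignLe (I.s .h) (I.s .t) := hI.2.2.1

/-! ## The coherent extension of an interpretation -/

/-- The extension of an intensional set, given the values of its tuples and the truth values of
its condition. -/
def extOf {A : Type} {k n : ℕ} (val : (Fin k → DD A) → Fin (n + 1) → Option (DD A))
    (cond : (Fin k → DD A) → Prop) : Option (DD A) :=
  if ∃ c, cond c ∧ ∃ i, val c i = none then none
  else mkSet? { v | ∃ (c : Fin k → DD A) (ds : Fin (n + 1) → DD A),
    cond c ∧ (∀ i, val c i = some (ds i)) ∧ v = famToTup ds }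

theorem extw_eq_extOf {S : Sig.{v}} (I : Interp S) (w : W) (k n : ℕ)
    (tv : (Fin k → D S) → Fin (n + 1) → GTerm S) (φ : (Fin k → D S) → Formula S) :
    extw I w k n tv φ = extOf (fun c i => I.s w (tv c i)) (fun c => SatS I w (φ c)) := rfl

/-- The value at a world of an intensional set whose extensions at the worlds are given by `E`. -/
def setVal {A : Type} (E : W → Option (DD A)) : W → Option (DD A)
  | .t => E .t
  | .h => if E .h = E .t then E .h else none

mutual
  /-- Evaluation of ground terms: intensional sets get their extensions, and constructors and
  evaluable functions applied to domain elements get their values in `I`. -/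
  def evalT {S : Sig.{v}} (I : Interp S) : GTerm S → W → Option (D S)
    | .dom d, _ => some d
    | .ctor c args, w =>
        (optFam fun i => evalT I (args i) w).bind fun ds => I.s w (.ctor c fun i => .dom (ds i))
    | .func f args, w =>
        (optFam fun i => evalT I (args i) w).bind fun ds => I.s w (.func f fun i => .dom (ds i))
    | .eset _ _ tups, w =>
        (optFam fun j => optFam fun i => evalT I (tups j i) w).bind
          fun g => mkSet? { v | ∃ j, v = famToTup (g j) }
    | .iset _ _ tv φ, w =>
        setVal (fun w' => extOf (fun c i => evalT I (tv c i) w')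
          (fun c => (evalF I (φ c) w').down)) w

  /-- Truth of sentences with respect to the evaluation `evalT` of their terms. -/
  def evalF {S : Sig.{v}} (I : Interp S) : Formula S → W → ULift.{1} Prop
    | .falsum, _ => ⟨False⟩
    | .verum, _ => ⟨True⟩
    | .atom p args, w => ⟨∃ ds : Fin (S.arP p) → D S,
        (∀ i, evalT I (args i) w = some (ds i)) ∧ (⟨p, ds⟩ : GAtom S) ∈ I.atoms w⟩
    | .eq t1 t2, w => ⟨∃ d, evalT I t1 w = some d ∧ evalT I t2 w = some d⟩
    | .and a b, w => ⟨(evalF I a w).down ∧ (evalF I b w).down⟩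
    | .or a b, w => ⟨(evalF I a w).down ∨ (evalF I b w).down⟩
    | .imp a b, w => ⟨∀ w', W.le w w' → ((evalF I a w').down → (evalF I b w').down)⟩
    | .all b, w => ⟨∀ d, (evalF I (b d) w).down⟩
    | .ex b, w => ⟨∃ d, (evalF I (b d) w).down⟩
end

/-- The interpretation with the evaluation `evalT I` as its assignments. -/
def coherentExt {S : Sig.{v}} (I : Interp S) : Interp S :=
  ⟨fun τ => evalT I τ .h, fun τ => evalT I τ .t, I.Ih, I.It⟩

theorem coherentExt_s {S : Sig.{v}} (I : Interp S) (w : W) (τ : GTerm S) :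
    (coherentExt I).s w τ = evalT I τ w := by
  cases w <;> rfl

theorem coherentExt_atoms {S : Sig.{v}} (I : Interp S) (w : W) :
    (coherentExt I).atoms w = I.atoms w := by
  cases w <;> rfl

theorem evalF_iff_satS {S : Sig.{v}} (I : Interp S) :
    ∀ (φ : Formula S) (w : W), (evalF I φ w).down ↔ SatS (coherentExt I) w φ
  | .falsum, w => by simp [evalF, SatS]
  | .verum, w => by simp [evalF, SatS]
  | .atom p args, w => by simp only [evalF, SatS, coherentExt_s, coherentExt_atoms]
  | .eq t1 t2, w => by simp only [evalF, SatS, coherentExt_s]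
  | .and a b, w => by simp only [evalF, SatS, evalF_iff_satS I a, evalF_iff_satS I b]
  | .or a b, w => by simp only [evalF, SatS, evalF_iff_satS I a, evalF_iff_satS I b]
  | .imp a b, w => by simp only [evalF, SatS, evalF_iff_satS I a, evalF_iff_satS I b]
  | .all b, w => by simp only [evalF, SatS, fun d => evalF_iff_satS I (b d)]
  | .ex b, w => by simp only [evalF, SatS, fun d => evalF_iff_satS I (b d)]

theorem evalT_ctor_dom {S : Sig.{v}} (I : Interp S) (c : S.C) (ds : Fin (S.arC c) → D S) (w : W) :
    evalT I (.ctor c fun i => .dom (ds i)) w = I.s w (.ctor c fun i => .dom (ds i)) := by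
  simp only [evalT, optFam_some, Option.bind_some]

theorem evalT_func_dom {S : Sig.{v}} (I : Interp S) (f : S.F) (ds : Fin (S.arF f) → D S) (w : W) :
    evalT I (.func f fun i => .dom (ds i)) w = I.s w (.func f fun i => .dom (ds i)) := by
  simp only [evalT, optFam_some, Option.bind_some]

theorem cval_ctor {S : Sig.{v}} (I : Interp S) (w : W) (c : S.C)
    (args : Fin (S.arC c) → GTerm S) : cval I w (.ctor c args) =
      (optFam fun i => cval I w (args i)).bind fun ds => I.s w (.ctor c fun i => .dom (ds i)) := by
  rw [cval]; cases optFam fun i => cval I w (args i) <;> rfl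

theorem cval_func {S : Sig.{v}} (I : Interp S) (w : W) (f : S.F)
    (args : Fin (S.arF f) → GTerm S) : cval I w (.func f args) =
      (optFam fun i => cval I w (args i)).bind fun ds => I.s w (.func f fun i => .dom (ds i)) := by
  rw [cval]; cases optFam fun i => cval I w (args i) <;> rfl

theorem cval_eset {S : Sig.{v}} (I : Interp S) (w : W) (m n : ℕ)
    (tups : Fin m → Fin (n + 1) → GTerm S) : cval I w (.eset m n tups) =
      (optFam fun j => optFam fun i => cval I w (tups j i)).bind
        fun g => mkSet? { v | ∃ j, v = famToTup (g j) } := by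
  rw [cval]; cases optFam fun j => optFam fun i => cval I w (tups j i) <;> rfl

theorem cval_iset {S : Sig.{v}} (I : Interp S) (w : W) (k n : ℕ)
    (tv : (Fin k → D S) → Fin (n + 1) → GTerm S) (φ : (Fin k → D S) → Formula S) :
    cval I w (.iset k n tv φ) = setVal (fun w' => extw I w' k n tv φ) w := by
  cases w <;> rfl

theorem cval_coherentExt {S : Sig.{v}} (I : Interp S) (w : W) :
    ∀ τ : GTerm S, cval (coherentExt I) w τ = evalT I τ w
  | .dom d => by simp only [cval, evalT]
  | .ctor c args => by
      simp only [cval_ctor, fun i => cval_coherentExt I w (args i), coherentExt_s,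
        evalT_ctor_dom]
      rw [evalT]
  | .func f args => by
      simp only [cval_func, fun i => cval_coherentExt I w (args i), coherentExt_s,
        evalT_func_dom]
      rw [evalT]
  | .eset m n tups => by
      simp only [cval_eset, fun j i => cval_coherentExt I w (tups j i)]
      rw [evalT]
  | .iset k n tv φ => by
      simp only [cval_iset, extw_eq_extOf, coherentExt_s, evalT, evalF_iff_satS]

theorem Interp.coherent_iff {S : Sig.{v}} (I : Interp S) :
    I.Coherent ↔ ∀ w τ, cval I w τ = I.s w τ := by
  constructor
  · intro h w τ
    cases w
    · exact congrFun (congrArg Interp.sh h) τ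
    · exact congrFun (congrArg Interp.st h) τ
  · intro h
    obtain ⟨sh, st, Ih, It⟩ := I
    simp only [Interp.Coherent, CohC, Interp.mk.injEq, and_true]
    exact ⟨funext fun τ => h .h τ, funext fun τ => h .t τ⟩

theorem coherentExt_coherent {S : Sig.{v}} (I : Interp S) : (coherentExt I).Coherent := by
  rw [Interp.coherent_iff]
  intro w τ
  rw [cval_coherentExt, coherentExt_s]

mutual
  theorem evalT_eq_of_coherent {S : Sig.{v}} {I K : Interp S}
      (hK : ∀ w τ, cval K w τ = K.s w τ) (hA : ∀ w, K.atoms w = I.atoms w)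
      (hs : ∀ w τ, IsZeroT τ → K.s w τ = I.s w τ) :
      ∀ (τ : GTerm S) (w : W), evalT I τ w = K.s w τ
    | .dom d, w => by rw [← hK]; simp only [cval, evalT]
    | .ctor c args, w => by
        rw [← hK, cval_ctor, evalT]
        simp only [fun i => evalT_eq_of_coherent hK hA hs (args i) w, hK]
        congr 1; funext ds
        exact (hs w _ (by simp [IsZeroT])).symm
    | .func f args, w => by
        rw [← hK, cval_func, evalT]
        simp only [fun i => evalT_eq_of_coherent hK hA hs (args i) w, hK]
        congr 1; funext ds
        exact (hs w _ (by simp [IsZeroT])).symm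
    | .eset m n tups, w => by
        rw [← hK, cval_eset, evalT]
        simp only [fun j i => evalT_eq_of_coherent hK hA hs (tups j i) w, hK]
    | .iset k n tv φ, w => by
        rw [← hK, cval_iset, evalT]
        simp only [extw_eq_extOf, fun c i => evalT_eq_of_coherent hK hA hs (tv c i),
          fun c => evalF_iff_of_coherent hK hA hs (φ c)]

  theorem evalF_iff_of_coherent {S : Sig.{v}} {I K : Interp S}
      (hK : ∀ w τ, cval K w τ = K.s w τ) (hA : ∀ w, K.atoms w = I.atoms w)
      (hs : ∀ w τ, IsZeroT τ → K.s w τ = I.s w τ) :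
      ∀ (φ : Formula S) (w : W), (evalF I φ w).down ↔ SatS K w φ
    | .falsum, w => by simp [evalF, SatS]
    | .verum, w => by simp [evalF, SatS]
    | .atom p args, w => by
        simp only [evalF, SatS, fun i => evalT_eq_of_coherent hK hA hs (args i) w, hA]
    | .eq t1 t2, w => by
        simp only [evalF, SatS, evalT_eq_of_coherent hK hA hs t1, evalT_eq_of_coherent hK hA hs t2]
    | .and a b, w => by
        simp only [evalF, SatS, evalF_iff_of_coherent hK hA hs a, evalF_iff_of_coherent hK hA hs b]
    | .or a b, w => by
        simp only [evalF, SatS, evalF_iff_of_coherent hK hA hs a, evalF_iff_of_coherent hK hA hs b]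
    | .imp a b, w => by
        simp only [evalF, SatS, evalF_iff_of_coherent hK hA hs a, evalF_iff_of_coherent hK hA hs b]
    | .all b, w => by
        simp only [evalF, SatS, fun d => evalF_iff_of_coherent hK hA hs (b d)]
    | .ex b, w => by
        simp only [evalF, SatS, fun d => evalF_iff_of_coherent hK hA hs (b d)]
end

theorem evalT_h_le_t {S : Sig.{v}} {I : Interp S} (hI : AssignLe (I.s .h) (I.s .t)) :
    ∀ τ : GTerm S, evalT I τ .h = evalT I τ .t ∨ evalT I τ .h = none
  | .dom d => by simp [evalT]
  | .ctor c args => by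
      simp only [evalT]
      rcases optFam_le fun i => evalT_h_le_t hI (args i) with h | h <;> rw [h]
      · cases optFam fun i => evalT I (args i) .t with
        | none => exact Or.inl rfl
        | some ds => exact hI _
      · exact Or.inr rfl
  | .func f args => by
      simp only [evalT]
      rcases optFam_le fun i => evalT_h_le_t hI (args i) with h | h <;> rw [h]
      · cases optFam fun i => evalT I (args i) .t with
        | none => exact Or.inl rfl
        | some ds => exact hI _
      · exact Or.inr rfl
  | .eset m n tups => by
      simp only [evalT]
      rcases optFam_le fun j => optFam_le fun i => evalT_h_le_t hI (tups j i) with h | h <;> rw [h]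
      · exact Or.inl rfl
      · exact Or.inr rfl
  | .iset k n tv φ => by
      simp only [evalT, setVal]
      split_ifs with h
      · exact Or.inl h
      · exact Or.inr rfl

theorem assignValid_coherentExt {S : Sig.{v}} {I : Interp S} (hI : I.Valid) (w : W) :
    AssignValid ((coherentExt I).s w) := by
  obtain ⟨-, -, hc, -, -⟩ := (assignValid_iff _).1 (hI.assign w)
  rw [assignValid_iff]
  simp only [coherentExt_s, evalT_ctor_dom, evalT_func_dom]
  exact ⟨fun d => by rw [evalT], fun c args => by rw [evalT], hc,
    fun f args => by rw [evalT], fun m n tups => by rw [evalT]⟩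

theorem coherentExt_valid {S : Sig.{v}} {I : Interp S} (hI : I.Valid) : (coherentExt I).Valid :=
  ⟨assignValid_coherentExt hI .h, assignValid_coherentExt hI .t, evalT_h_le_t hI.s_h_le, hI.2.2.2⟩

/-- On terms without intensional sets, evaluation agrees with the assignments. -/
theorem evalT_eq_of_isZeroT {S : Sig.{v}} {I : Interp S} {w : W} (hI : AssignValid (I.s w)) :
    ∀ τ : GTerm S, IsZeroT τ → evalT I τ w = I.s w τ
  | .dom d, _ => by rw [evalT, ((assignValid_iff _).1 hI).1]
  | .ctor c args, h => by
      rw [IsZeroT] at h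
      rw [evalT, ((assignValid_iff _).1 hI).2.1]
      simp only [fun i => evalT_eq_of_isZeroT hI (args i) (h i)]
  | .func f args, h => by
      rw [IsZeroT] at h
      rw [evalT, ((assignValid_iff _).1 hI).2.2.2.1]
      simp only [fun i => evalT_eq_of_isZeroT hI (args i) (h i)]
  | .eset m n tups, h => by
      rw [IsZeroT] at h
      rw [evalT, ((assignValid_iff _).1 hI).2.2.2.2]
      simp only [fun j i => evalT_eq_of_isZeroT hI (tups j i) (h j i)]
  | .iset k n tv φ, h => by
      rw [IsZeroT] at h
      exact h.elim

mutual
  theorem evalT_congr_t {S : Sig.{v}} {I K : Interp S} (hs : I.st = K.st) (hA : I.It = K.It) :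
      ∀ τ : GTerm S, evalT I τ .t = evalT K τ .t
    | .dom d => by simp only [evalT]
    | .ctor c args => by
        simp only [evalT, fun i => evalT_congr_t hs hA (args i), Interp.s, hs]
    | .func f args => by
        simp only [evalT, fun i => evalT_congr_t hs hA (args i), Interp.s, hs]
    | .eset m n tups => by
        simp only [evalT, fun j i => evalT_congr_t hs hA (tups j i)]
    | .iset k n tv φ => by
        simp only [evalT, setVal, fun c i => evalT_congr_t hs hA (tv c i),
          fun c => evalF_congr_t hs hA (φ c)]

  theorem evalF_congr_t {S : Sig.{v}} {I K : Interp S} (hs : I.st = K.st) (hA : I.It = K.It) :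
      ∀ φ : Formula S, evalF I φ .t = evalF K φ .t
    | .falsum => by simp only [evalF]
    | .verum => by simp only [evalF]
    | .atom p args => by
        simp only [evalF, fun i => evalT_congr_t hs hA (args i), Interp.atoms, hA]
    | .eq t1 t2 => by simp only [evalF, evalT_congr_t hs hA t1, evalT_congr_t hs hA t2]
    | .and a b => by simp only [evalF, evalF_congr_t hs hA a, evalF_congr_t hs hA b]
    | .or a b => by simp only [evalF, evalF_congr_t hs hA a, evalF_congr_t hs hA b]
    | .imp a b => by
        have ha := evalF_congr_t hs hA a
        have hb := evalF_congr_t hs hA b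
        simp only [evalF, ULift.up.injEq, eq_iff_iff]
        refine forall_congr' fun w => ?_
        cases w
        · simp [W.le]
        · rw [ha, hb]
    | .all b => by simp only [evalF, fun d => evalF_congr_t hs hA (b d)]
    | .ex b => by simp only [evalF, fun d => evalF_congr_t hs hA (b d)]
end

theorem totalI_s {S : Sig.{v}} (σ : Assign S) (T : Set (GAtom S)) (w : W) :
    (totalI σ T).s w = σ := by
  cases w <;> rfl

theorem totalI_atoms {S : Sig.{v}} (σ : Assign S) (T : Set (GAtom S)) (w : W) :
    (totalI σ T).atoms w = T := by
  cases w <;> rfl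

mutual
  theorem evalT_total {S : Sig.{v}} (σ : Assign S) (T : Set (GAtom S)) :
      ∀ τ : GTerm S, evalT (totalI σ T) τ .h = evalT (totalI σ T) τ .t
    | .dom d => by simp only [evalT]
    | .ctor c args => by
        simp only [evalT, fun i => evalT_total σ T (args i), totalI_s]
    | .func f args => by
        simp only [evalT, fun i => evalT_total σ T (args i), totalI_s]
    | .eset m n tups => by
        simp only [evalT, fun j i => evalT_total σ T (tups j i)]
    | .iset k n tv φ => by
        simp only [evalT, setVal, fun c i => evalT_total σ T (tv c i),
          fun c => evalF_total σ T (φ c), if_true]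

  theorem evalF_total {S : Sig.{v}} (σ : Assign S) (T : Set (GAtom S)) :
      ∀ φ : Formula S, evalF (totalI σ T) φ .h = evalF (totalI σ T) φ .t
    | .falsum => by simp only [evalF]
    | .verum => by simp only [evalF]
    | .atom p args => by
        simp only [evalF, fun i => evalT_total σ T (args i), totalI_atoms]
    | .eq t1 t2 => by simp only [evalF, evalT_total σ T t1, evalT_total σ T t2]
    | .and a b => by simp only [evalF, evalF_total σ T a, evalF_total σ T b]
    | .or a b => by simp only [evalF, evalF_total σ T a, evalF_total σ T b]
    | .imp a b => by
        have ha := evalF_total σ T a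
        have hb := evalF_total σ T b
        simp only [evalF, ULift.up.injEq, eq_iff_iff]
        constructor
        · intro h w _
          exact h w trivial
        · intro h w _
          cases w
          · rw [ha, hb]
            exact h .t trivial
          · exact h .t trivial
    | .all b => by simp only [evalF, fun d => evalF_total σ T (b d)]
    | .ex b => by simp only [evalF, fun d => evalF_total σ T (b d)]
end

/-! ## Comparing the two semantics -/

theorem satS_congr_of_isZeroF {S : Sig.{v}} {I K : Interp S}
    (hA : ∀ w, I.atoms w = K.atoms w) (hs : ∀ w τ, IsZeroT τ → I.s w τ = K.s w τ) :
    ∀ φ : Formula S, IsZeroF φ → ∀ w, SatS I w φ ↔ SatS K w φ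
  | .falsum, _, w => by simp only [SatS]
  | .verum, _, w => by simp only [SatS]
  | .atom p args, h, w => by
      rw [IsZeroF] at h
      simp only [SatS, fun i => hs w _ (h i), hA]
  | .eq t1 t2, h, w => by
      rw [IsZeroF] at h
      simp only [SatS, hs w _ h.1, hs w _ h.2]
  | .and a b, h, w => by
      rw [IsZeroF] at h
      simp only [SatS, satS_congr_of_isZeroF hA hs a h.1, satS_congr_of_isZeroF hA hs b h.2]
  | .or a b, h, w => by
      rw [IsZeroF] at h
      simp only [SatS, satS_congr_of_isZeroF hA hs a h.1, satS_congr_of_isZeroF hA hs b h.2]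
  | .imp a b, h, w => by
      rw [IsZeroF] at h
      simp only [SatS, satS_congr_of_isZeroF hA hs a h.1, satS_congr_of_isZeroF hA hs b h.2]
  | .all b, h, w => by
      rw [IsZeroF] at h
      simp only [SatS, fun d => satS_congr_of_isZeroF hA hs (b d) (h d)]
  | .ex b, h, w => by
      rw [IsZeroF] at h
      simp only [SatS, fun d => satS_congr_of_isZeroF hA hs (b d) (h d)]

theorem hat_toInterp_atoms {S : Sig.{v}} (I : Interp S) (w : W) :
    I.hat.toInterp.atoms w = I.atoms w := by
  cases w <;> rfl

theorem hat_toInterp_s {S : Sig.{v}} (I : Interp S) (w : W) (τ : GTerm S) :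
    I.hat.toInterp.s w τ = if IsZeroT τ then I.s w τ else none := by
  cases w <;> simp [Interp.hat, FInterp.toInterp, Interp.s]

theorem satF_hat {S : Sig.{v}} (I : Interp S) {φ : Formula S} (hφ : IsZeroF φ) (w : W) :
    SatF I.hat w φ ↔ SatS I w φ :=
  satS_congr_of_isZeroF (hat_toInterp_atoms I)
    (fun w τ hτ => by rw [hat_toInterp_s, if_pos hτ]) φ hφ w

/-- Restricting an assignment to the terms without intensional sets preserves validity. -/
theorem AssignValid.restrict {S : Sig.{v}} {σ : Assign S} (hσ : AssignValid σ) :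
    AssignValid fun τ => if IsZeroT τ then σ τ else none := by
  obtain ⟨h1, h2, h3, h4, h5, h6, h7, h8⟩ := hσ
  have key : ∀ (τ : GTerm S) (d : D S),
      (if IsZeroT τ then σ τ else none) = some d ↔ IsZeroT τ ∧ σ τ = some d := by
    intro τ d
    split_ifs with h <;> simp [h]
  refine ⟨fun d => ?_, fun c args h => ?_, fun c args ds h => ?_, fun c hs => ?_,
    fun f args h => ?_, fun f args ds h => ?_, fun m n tups h => ?_, fun m n tups ds h => ?_⟩
  · simp [IsZeroT, h1]
  · obtain ⟨i, hi⟩ := h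
    refine ite_eq_right_iff.2 fun hz => ?_
    rw [IsZeroT] at hz
    exact h2 c args ⟨i, by simpa [hz i] using hi⟩
  · simp only [key] at h
    simpa [IsZeroT, fun i => (h i).1] using h3 c args ds fun i => (h i).2
  · simpa [IsZeroT] using h4 c hs
  · obtain ⟨i, hi⟩ := h
    refine ite_eq_right_iff.2 fun hz => ?_
    rw [IsZeroT] at hz
    exact h5 f args ⟨i, by simpa [hz i] using hi⟩
  · simp only [key] at h
    simpa [IsZeroT, fun i => (h i).1] using h6 f args ds fun i => (h i).2
  · obtain ⟨j, i, hi⟩ := h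
    refine ite_eq_right_iff.2 fun hz => ?_
    rw [IsZeroT] at hz
    exact h7 m n tups ⟨j, i, by simpa [hz j i] using hi⟩
  · simp only [key] at h
    simpa [IsZeroT, fun j i => (h j i).1] using h8 m n tups ds fun j i => (h j i).2

theorem hat_valid {S : Sig.{v}} {I : Interp S} (hI : I.Valid) : I.hat.Valid := by
  have hs : ∀ w, I.hat.toInterp.s w = fun τ => if IsZeroT τ then I.s w τ else none :=
    fun w => funext (hat_toInterp_s I w)
  have hv : ∀ w, AssignValid (I.hat.toInterp.s w) := fun w => by
    rw [hs]
    exact (hI.assign w).restrict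
  refine ⟨hv .h, hv .t, fun τ => ?_, hI.2.2.2⟩
  change I.hat.toInterp.s .h τ = I.hat.toInterp.s .t τ ∨ I.hat.toInterp.s .h τ = none
  simp only [hat_toInterp_s]
  split_ifs
  · exact hI.s_h_le τ
  · exact Or.inl rfl

theorem ModelS.hat {S : Sig.{v}} {I : Interp S} {Γ : Set (Formula S)}
    (hΓ : ∀ φ ∈ Γ, IsZeroF φ) (hI : ModelS I Γ) : ModelF I.hat Γ :=
  ⟨hat_valid hI.1, fun φ hφ => (satF_hat I (hΓ φ hφ) .h).2 (hI.2.2 φ hφ)⟩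

/-- The coherent interpretation extending an interpretation defined on the terms without
intensional sets. -/
def FInterp.lift {S : Sig.{v}} (J : FInterp S) : Interp S := coherentExt J.toInterp

theorem FInterp.Valid.hat_lift {S : Sig.{v}} {J : FInterp S} (hJ : J.Valid) : J.lift.hat = J := by
  have hs : ∀ w τ, IsZeroT τ → evalT J.toInterp τ w = J.toInterp.s w τ :=
    fun w => evalT_eq_of_isZeroT (Interp.Valid.assign hJ w)
  obtain ⟨sh, st, Ih, It⟩ := J
  simp only [FInterp.lift, coherentExt, Interp.hat, FInterp.mk.injEq]
  refine ⟨funext fun τ => ?_, funext fun τ => ?_, rfl, rfl⟩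
  · rw [hs .h _ τ.2]
    simp [FInterp.toInterp, Interp.s, τ.2]
  · rw [hs .t _ τ.2]
    simp [FInterp.toInterp, Interp.s, τ.2]

theorem Interp.Coherent.lift_hat {S : Sig.{v}} {I : Interp S} (hI : I.Coherent) :
    I.hat.lift = I := by
  have hs := evalT_eq_of_coherent (I := I.hat.toInterp) ((Interp.coherent_iff I).1 hI)
    (fun w => (hat_toInterp_atoms I w).symm)
    (fun w τ hτ => by rw [hat_toInterp_s, if_pos hτ])
  obtain ⟨sh, st, Ih, It⟩ := I
  simp only [FInterp.lift, coherentExt, Interp.mk.injEq]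
  exact ⟨funext fun τ => hs τ .h, funext fun τ => hs τ .t, rfl, rfl⟩

theorem ModelF.lift {S : Sig.{v}} {J : FInterp S} {Γ : Set (Formula S)}
    (hΓ : ∀ φ ∈ Γ, IsZeroF φ) (hJ : ModelF J Γ) : ModelS J.lift Γ := by
  refine ⟨coherentExt_valid hJ.1, coherentExt_coherent _, fun φ hφ => ?_⟩
  rw [← satF_hat J.lift (hΓ φ hφ), hJ.1.hat_lift]
  exact hJ.2 φ hφ

theorem lift_totalF {S : Sig.{v}} (σ : { τ : GTerm S // IsZeroT τ } → Option (D S))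
    (T : Set (GAtom S)) : (totalF σ T).lift = totalI (totalF σ T).lift.st T := by
  simp only [FInterp.lift, coherentExt, totalI, Interp.mk.injEq]
  exact ⟨funext fun τ => evalT_total _ T τ, trivial, rfl, rfl⟩

theorem ILe.hat {S : Sig.{v}} {I K : Interp S} (h : ILe I K) : FILe I.hat K.hat :=
  ⟨h.1, by simp only [Interp.hat, h.2.1], h.2.2.1, fun τ => h.2.2.2 τ.1⟩

theorem FILe.lift_totalF {S : Sig.{v}} {J : FInterp S}
    {σ : { τ : GTerm S // IsZeroT τ } → Option (D S)} {T : Set (GAtom S)} (hJ : J.Valid)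
    (h : FILe J (totalF σ T)) : ILe J.lift (totalF σ T).lift := by
  have ht : ∀ τ, evalT J.toInterp τ .t = evalT (totalF σ T).toInterp τ .t :=
    evalT_congr_t (by simp only [FInterp.toInterp, h.2.1]) h.1
  refine ⟨h.1, funext ht, h.2.2.1, fun τ => ?_⟩
  have hle := evalT_h_le_t (Interp.Valid.s_h_le hJ) τ
  rw [ht τ, ← show evalT (totalF σ T).toInterp τ .h = evalT (totalF σ T).toInterp τ .t from
    evalT_total _ T τ] at hle
  exact hle


/-- For a theory `Γ` consisting only of `0`-formulas over
`Σ = ⟨C, F, P⟩` and a set of ground atoms `T`: `T` is a stable model of `Γ`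
under the `SQHT⁼_𝒮` equilibrium semantics iff `T` is a stable model of `Γ`
under the `SQHT⁼_F` equilibrium semantics over `⟨C ∪ 𝒮, F, P⟩`. -/
theorem stableS_iff_stableF {S : Sig.{v}} (Γ : Set (Formula S))
    (hΓ : ∀ φ ∈ Γ, IsZeroF φ) (T : Set (GAtom S)) :
    StableS Γ T ↔ StableF Γ T := by
  constructor
  · rintro ⟨σ, hM, hmin⟩
    refine ⟨fun τ => σ τ.1, hM.hat hΓ, fun J hlt hJ => hmin J.lift ⟨?_, fun heq => ?_⟩ (hJ.lift hΓ)⟩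
    · have hle := hlt.1.lift_totalF hJ.1
      rwa [show (totalF (fun τ => σ τ.1) T).lift = totalI σ T from hM.2.1.lift_hat] at hle
    · refine hlt.2 ?_
      rw [← hJ.1.hat_lift, heq]
      rfl
  · rintro ⟨σ, hM, hmin⟩
    refine ⟨(totalF σ T).lift.st, ?_⟩
    rw [EqModelS, ← lift_totalF]
    refine ⟨hM.lift hΓ, fun I hlt hI => hmin I.hat ⟨?_, fun heq => hlt.2 ?_⟩ (hI.hat hΓ)⟩
    · have hle := hlt.1.hat
      rwa [hM.1.hat_lift] at hle
    · rw [← hI.2.1.lift_hat, heq]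

end
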